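/- Let G be a P5-free graph and let A and B be disjoint nonempty vertex sets of G such that there are no edges between A and B and both induced subgraphs G[A] and G[B] are connected. Then every vertex v of G outside A ∪ B is consistent to A or consistent to B; that is, v is complete or anticomplete to A, or v is complete or anticomplete to B. -/

import Mathlib

open SimpleGraph

/-- A set of vertices is homogeneous if it induces a clique or an independent set. -/
def IsHomogeneous {V : Type*} (G : SimpleGraph V) (s : Finset V) : Prop :=
  G.IsClique (s : Set V) ∨ Gᶜ.IsClique (s : Set V)

/-- `hom(G)`: the largest size of a homogeneous set in `G`. -/
noncomputable def homNum {V : Type*} (G : SimpleGraph V) : ℕ :=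
  sSup {k : ℕ | ∃ s : Finset V, IsHomogeneous G s ∧ s.card = k}

/-- `G` contains no induced copy of `H`. -/
def IndFree {W V : Type*} (H : SimpleGraph W) (G : SimpleGraph V) : Prop :=
  ¬ Nonempty (H ↪g G)

/-- `G` has no induced path on five vertices. -/
def P5Free {V : Type*} (G : SimpleGraph V) : Prop :=
  IndFree (pathGraph 5) G

theorem exists_mixed_edge {V : Type} (G : SimpleGraph V) (A : Set V)
    (hAc : (G.induce A).Connected) (v : V)
    (h1 : ∃ a ∈ A, ¬ G.Adj v a) (h2 : ∃ a ∈ A, G.Adj v a) :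
    ∃ a ∈ A, ∃ a' ∈ A, G.Adj a a' ∧ G.Adj v a ∧ ¬ G.Adj v a' := by
  obtain ⟨x, hx, hvx⟩ := h1
  obtain ⟨y, hy, hvy⟩ := h2
  obtain ⟨p⟩ := hAc.preconnected ⟨y, hy⟩ ⟨x, hx⟩
  obtain ⟨d, -, h3, h4⟩ := p.exists_boundary_dart {z | G.Adj v z.1} hvy hvx
  exact ⟨d.fst.1, d.fst.2, d.snd.1, d.snd.2, d.adj, h3, h4⟩

theorem stmt_13 {V : Type} [Fintype V] (G : SimpleGraph V) (hP5 : P5Free G)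
    (A B : Set V) (hA : A.Nonempty) (hB : B.Nonempty) (hd : Disjoint A B)
    (hanti : ∀ a ∈ A, ∀ b ∈ B, ¬ G.Adj a b)
    (hAc : (G.induce A).Connected) (hBc : (G.induce B).Connected)
    (v : V) (hv : v ∉ A ∪ B) :
    ((∀ a ∈ A, G.Adj v a) ∨ (∀ a ∈ A, ¬ G.Adj v a)) ∨
    ((∀ b ∈ B, G.Adj v b) ∨ (∀ b ∈ B, ¬ G.Adj v b)) := by
  by_contra hcon
  push Not at hcon
  obtain ⟨⟨h1, h2⟩, h3, h4⟩ := hcon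
  obtain ⟨a, ha, a', ha', haa, hva, hva'⟩ := exists_mixed_edge G A hAc v h1 h2
  obtain ⟨b, hb, b', hb', hbb, hvb, hvb'⟩ := exists_mixed_edge G B hBc v h3 h4
  have n1 := hanti a ha b hb
  have n2 := hanti a ha b' hb'
  have n3 := hanti a' ha' b hb
  have n4 := hanti a' ha' b' hb'
  have key : ∀ i j : Fin 5, G.Adj (![a', a, v, b, b'] i) (![a', a, v, b, b'] j) ↔
      (pathGraph 5).Adj i j := by
    intro i j
    rw [pathGraph_adj]
    fin_cases i <;> fin_cases j <;>
      simp [haa, haa.symm, hva, hva.symm, hva', hvb, hvb.symm, hvb', hbb, hbb.symm,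
        n1, n2, n3, n4, G.adj_comm a' v, G.adj_comm b' v, G.adj_comm b a, G.adj_comm b' a,
        G.adj_comm b a', G.adj_comm b' a']
  refine hP5 ⟨⟨⟨![a', a, v, b, b'], ?_⟩, key _ _⟩⟩
  intro i j hij
  have h : ∀ k, (pathGraph 5).Adj i k ↔ (pathGraph 5).Adj j k := by
    intro k
    rw [← key, ← key, hij]
  simp only [pathGraph_adj] at h
  revert h
  revert i j
  have : ∀ i j : Fin 5, (∀ k : Fin 5, (i.val + 1 = k.val ∨ k.val + 1 = i.val) ↔
    (j.val + 1 = k.val ∨ k.val + 1 = j.val)) → i = j := by decide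
  intro i j _ h
  exact this i j h
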